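/- For every LTL formula Φ in the syntactic class TL_Streett, there exists a deterministic ω-automaton A over the alphabet 2^V with a Streett acceptance condition (given by finitely many pairs of state sets (F_j, E_j) for j = 0,…,f, a run β is accepting iff for every j, either β visits F_j infinitely often or β stays in E_j from some point on) such that A has at most 2^(2^|Φ|) states and A accepts exactly the set of infinite words w with w ⊨ Φ. -/

import Mathlib

/-- LTL formulas over atomic propositions `V`: the constant `true`, variables,
negation, disjunction, next (`X`), and strong until (`SU`). -/
inductive LTL (V : Type) : Type
  | tt : LTL V
  | var : V → LTL V
  | lnot : LTL V → LTL V
  | lor : LTL V → LTL V → LTL V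
  | lnext : LTL V → LTL V
  | lsu : LTL V → LTL V → LTL V

namespace LTL

variable {V : Type}

/-- Semantics: `Sat w φ i` means `w, i ⊨ φ` for an infinite word `w : ℕ → Set V`.
In particular `w, i ⊨ ψ SU φ` iff there is `k ≥ i` with `w, k ⊨ ψ` and
`w, j ⊨ φ` for all `i ≤ j < k`. -/
def Sat (w : ℕ → Set V) : LTL V → ℕ → Prop
  | tt, _ => True
  | var v, i => v ∈ w i
  | lnot φ, i => ¬ Sat w φ i
  | lor φ ψ, i => Sat w φ i ∨ Sat w ψ i
  | lnext φ, i => Sat w φ (i + 1)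
  | lsu ψ φ, i => ∃ k, i ≤ k ∧ Sat w ψ k ∧ ∀ j, i ≤ j → j < k → Sat w φ j

/-- Conjunction, as the abbreviation `¬(¬φ ∨ ¬ψ)`. -/
def land (φ ψ : LTL V) : LTL V := lnot (lor (lnot φ) (lnot ψ))

/-- `F φ := φ SU true`. -/
def lF (φ : LTL V) : LTL V := lsu φ tt

/-- `G φ := ¬ F ¬ φ`. -/
def lG (φ : LTL V) : LTL V := lnot (lF (lnot φ))

/-- Weak until: `ψ U φ := (ψ SU φ) ∨ G φ`. -/
def lwu (ψ φ : LTL V) : LTL V := lor (lsu ψ φ) (lG φ)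

/-- Number of nodes of the syntax tree. -/
def size : LTL V → ℕ
  | tt => 1
  | var _ => 1
  | lnot φ => size φ + 1
  | lor φ ψ => size φ + size ψ + 1
  | lnext φ => size φ + 1
  | lsu ψ φ => size ψ + size φ + 1

mutual
  /-- The syntactic class `TL_G`. -/
  inductive TLG : LTL V → Prop
    | var (v : V) : TLG (LTL.var v)
    | not {φ : LTL V} : TLF φ → TLG (LTL.lnot φ)
    | and {φ ψ : LTL V} : TLG φ → TLG ψ → TLG (LTL.land φ ψ)
    | or {φ ψ : LTL V} : TLG φ → TLG ψ → TLG (LTL.lor φ ψ)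
    | next {φ : LTL V} : TLG φ → TLG (LTL.lnext φ)
    | alw {φ : LTL V} : TLG φ → TLG (LTL.lG φ)
    | wu {ψ φ : LTL V} : TLG ψ → TLG φ → TLG (LTL.lwu ψ φ)
  /-- The syntactic class `TL_F`. -/
  inductive TLF : LTL V → Prop
    | var (v : V) : TLF (LTL.var v)
    | not {φ : LTL V} : TLG φ → TLF (LTL.lnot φ)
    | and {φ ψ : LTL V} : TLF φ → TLF ψ → TLF (LTL.land φ ψ)
    | or {φ ψ : LTL V} : TLF φ → TLF ψ → TLF (LTL.lor φ ψ)
    | next {φ : LTL V} : TLF φ → TLF (LTL.lnext φ)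
    | ev {φ : LTL V} : TLF φ → TLF (LTL.lF φ)
    | su {ψ φ : LTL V} : TLF ψ → TLF φ → TLF (LTL.lsu ψ φ)
end

end LTL

/-- The unique run of a deterministic automaton with transition function `δ`
and initial state `s0` on the infinite word `w`. -/
def detRun {S A : Type} (δ : S → A → S) (s0 : S) (w : ℕ → A) : ℕ → S
  | 0 => s0
  | t + 1 => δ (detRun δ s0 w t) (w t)

namespace LTL

variable {V : Type}

/-- The syntactic class `TL_Prefix`: the closure of `TL_G ∪ TL_F` under `¬, ∧, ∨`. -/
inductive TLPrefix : LTL V → Prop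
  | g {φ : LTL V} : TLG φ → TLPrefix φ
  | f {φ : LTL V} : TLF φ → TLPrefix φ
  | not {φ : LTL V} : TLPrefix φ → TLPrefix (LTL.lnot φ)
  | and {φ ψ : LTL V} : TLPrefix φ → TLPrefix ψ → TLPrefix (LTL.land φ ψ)
  | or {φ ψ : LTL V} : TLPrefix φ → TLPrefix ψ → TLPrefix (LTL.lor φ ψ)

end LTL

namespace LTL

variable {V : Type}

mutual
  /-- The syntactic class `TL_GF`. -/
  inductive TLGF : LTL V → Prop
    | pre {φ : LTL V} : TLPrefix φ → TLGF φ
    | not {φ : LTL V} : TLFG φ → TLGF (LTL.lnot φ)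
    | and {φ ψ : LTL V} : TLGF φ → TLGF ψ → TLGF (LTL.land φ ψ)
    | or {φ ψ : LTL V} : TLGF φ → TLGF ψ → TLGF (LTL.lor φ ψ)
    | next {φ : LTL V} : TLGF φ → TLGF (LTL.lnext φ)
    | alw {φ : LTL V} : TLGF φ → TLGF (LTL.lG φ)
    | wu {ψ φ : LTL V} : TLGF ψ → TLGF φ → TLGF (LTL.lwu ψ φ)
    | suF {ψ φ : LTL V} : TLF ψ → TLGF φ → TLGF (LTL.lsu ψ φ)
  /-- The syntactic class `TL_FG`. -/
  inductive TLFG : LTL V → Prop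
    | pre {φ : LTL V} : TLPrefix φ → TLFG φ
    | not {φ : LTL V} : TLGF φ → TLFG (LTL.lnot φ)
    | and {φ ψ : LTL V} : TLFG φ → TLFG ψ → TLFG (LTL.land φ ψ)
    | or {φ ψ : LTL V} : TLFG φ → TLFG ψ → TLFG (LTL.lor φ ψ)
    | next {φ : LTL V} : TLFG φ → TLFG (LTL.lnext φ)
    | ev {φ : LTL V} : TLFG φ → TLFG (LTL.lF φ)
    | su {ψ φ : LTL V} : TLFG ψ → TLFG φ → TLFG (LTL.lsu ψ φ)
    | wuG {ψ φ : LTL V} : TLFG ψ → TLG φ → TLFG (LTL.lwu ψ φ)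
end

/-- The syntactic class `TL_Streett`: the closure of `TL_GF ∪ TL_FG` under `¬, ∧, ∨`. -/
inductive TLStreett : LTL V → Prop
  | gf {φ : LTL V} : TLGF φ → TLStreett φ
  | fg {φ : LTL V} : TLFG φ → TLStreett φ
  | not {φ : LTL V} : TLStreett φ → TLStreett (LTL.lnot φ)
  | and {φ ψ : LTL V} : TLStreett φ → TLStreett ψ → TLStreett (LTL.land φ ψ)
  | or {φ ψ : LTL V} : TLStreett φ → TLStreett ψ → TLStreett (LTL.lor φ ψ)

end LTL

open Filter

/-- LTL formulas in negation normal form; `rel χ γ` is the release operator, dual to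
strong until: `γ` has to hold up to and including the first position where `χ` holds. -/
inductive NNF (V : Type) : Type
  | top : NNF V
  | bot : NNF V
  | pos : V → NNF V
  | neg : V → NNF V
  | and : NNF V → NNF V → NNF V
  | or : NNF V → NNF V → NNF V
  | next : NNF V → NNF V
  | su : NNF V → NNF V → NNF V
  | rel : NNF V → NNF V → NNF V

namespace NNF

variable {V : Type}

/-- Semantics of negation normal forms. -/
def Sat (w : ℕ → Set V) : NNF V → ℕ → Prop
  | top, _ => True
  | bot, _ => False
  | pos v, i => v ∈ w i
  | neg v, i => v ∉ w i
  | and φ ψ, i => Sat w φ i ∧ Sat w ψ i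
  | or φ ψ, i => Sat w φ i ∨ Sat w ψ i
  | next φ, i => Sat w φ (i + 1)
  | su ψ φ, i => ∃ k, i ≤ k ∧ Sat w ψ k ∧ ∀ j, i ≤ j → j < k → Sat w φ j
  | rel χ γ, i => ∀ k, i ≤ k → Sat w γ k ∨ ∃ j, i ≤ j ∧ j < k ∧ Sat w χ j

/-- The temporal subformulas, used as possible obligations for the next position. -/
noncomputable def atoms : NNF V → Finset (NNF V)
  | top => ∅
  | bot => ∅
  | pos _ => ∅
  | neg _ => ∅
  | and φ ψ => open Classical in atoms φ ∪ atoms ψ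
  | or φ ψ => open Classical in atoms φ ∪ atoms ψ
  | next φ => open Classical in insert (next φ) (atoms φ)
  | su ψ φ => open Classical in insert (su ψ φ) (atoms ψ ∪ atoms φ)
  | rel χ γ => open Classical in insert (rel χ γ) (atoms χ ∪ atoms γ)

/-- What an obligation asserts about the position at which it is pending. -/
def body : NNF V → NNF V
  | next φ => φ
  | φ => φ

/-- Local evaluation of a formula, given the current letter and the set of obligations
pending at the next position. -/
def Eval (a : Set V) (O : Set (NNF V)) : NNF V → Prop
  | top => True
  | bot => False
  | pos v => v ∈ a
  | neg v => v ∉ a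
  | and φ ψ => Eval a O φ ∧ Eval a O ψ
  | or φ ψ => Eval a O φ ∨ Eval a O ψ
  | next φ => next φ ∈ O
  | su ψ φ => Eval a O ψ ∨ (Eval a O φ ∧ su ψ φ ∈ O)
  | rel χ γ => Eval a O γ ∧ (Eval a O χ ∨ rel χ γ ∈ O)

/-- Strong-until formulas, the only obligations that may not stay pending forever. -/
def IsSU : NNF V → Prop
  | su _ _ => True
  | _ => False

/-- Formulas without strong until. -/
def Safe : NNF V → Prop
  | top => True
  | bot => True
  | pos _ => True
  | neg _ => True
  | and φ ψ => Safe φ ∧ Safe ψ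
  | or φ ψ => Safe φ ∧ Safe ψ
  | next φ => Safe φ
  | su _ _ => False
  | rel χ γ => Safe χ ∧ Safe γ

/-- Formulas whose release operators have a safe second argument. -/
def Persistent : NNF V → Prop
  | top => True
  | bot => True
  | pos _ => True
  | neg _ => True
  | and φ ψ => Persistent φ ∧ Persistent ψ
  | or φ ψ => Persistent φ ∧ Persistent ψ
  | next φ => Persistent φ
  | su ψ φ => Persistent ψ ∧ Persistent φ
  | rel χ γ => Persistent χ ∧ Safe γ

theorem Safe.persistent {φ : NNF V} (h : Safe φ) : Persistent φ := by
  induction φ <;> simp_all [Safe, Persistent]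

theorem Eval.mono {a : Set V} {O O' : Set (NNF V)} (hO : O ⊆ O') {φ : NNF V}
    (h : Eval a O φ) : Eval a O' φ := by
  induction φ with
  | top | bot | pos | neg => exact h
  | and φ ψ ihφ ihψ => exact ⟨ihφ h.1, ihψ h.2⟩
  | or φ ψ ihφ ihψ => exact h.imp ihφ ihψ
  | next φ _ => exact hO h
  | su ψ φ ihψ ihφ => exact h.imp ihψ fun h => ⟨ihφ h.1, hO h.2⟩
  | rel χ γ ihχ ihγ => exact ⟨ihγ h.1, h.2.imp ihχ fun h => hO h⟩

theorem Eval.inter_atoms {a : Set V} {O A : Set (NNF V)} {φ : NNF V}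
    (hA : ∀ x ∈ atoms φ, x ∈ A) (h : Eval a O φ) : Eval a (O ∩ A) φ := by
  induction φ with
  | top | bot | pos | neg => exact h
  | and φ ψ ihφ ihψ =>
    simp only [atoms, Finset.mem_union] at hA
    exact ⟨ihφ (fun x hx => hA x (.inl hx)) h.1, ihψ (fun x hx => hA x (.inr hx)) h.2⟩
  | or φ ψ ihφ ihψ =>
    simp only [atoms, Finset.mem_union] at hA
    exact h.imp (ihφ fun x hx => hA x (.inl hx)) (ihψ fun x hx => hA x (.inr hx))
  | next φ _ => exact ⟨h, hA _ (by simp [atoms])⟩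
  | su ψ φ ihψ ihφ =>
    simp only [atoms, Finset.mem_union, Finset.mem_insert] at hA
    exact h.imp (ihψ fun x hx => hA x (.inr (.inl hx)))
      fun h => ⟨ihφ (fun x hx => hA x (.inr (.inr hx))) h.1, h.2, hA _ (.inl rfl)⟩
  | rel χ γ ihχ ihγ =>
    simp only [atoms, Finset.mem_union, Finset.mem_insert] at hA
    exact ⟨ihγ (fun x hx => hA x (.inr (.inr hx))) h.1,
      h.2.imp (ihχ fun x hx => hA x (.inr (.inl hx))) fun h => ⟨h, hA _ (.inl rfl)⟩⟩

theorem atoms_body_subset {x φ : NNF V} (hx : x ∈ atoms φ) : atoms (body x) ⊆ atoms φ := by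
  induction φ with
  | top | bot | pos | neg => simp [atoms] at hx
  | and φ ψ ihφ ihψ | or φ ψ ihφ ihψ =>
    simp only [Finset.subset_iff, atoms, Finset.mem_union] at *
    exact hx.elim (fun hx y hy => .inl (ihφ hx hy)) fun hx y hy => .inr (ihψ hx hy)
  | next φ ih =>
    simp only [Finset.subset_iff, atoms, Finset.mem_insert] at *
    rcases hx with rfl | hx
    · exact fun y hy => .inr hy
    · exact fun y hy => .inr (ih hx hy)
  | su ψ φ ihφ ihψ | rel ψ φ ihφ ihψ =>
    simp only [Finset.subset_iff, atoms, Finset.mem_union, Finset.mem_insert] at *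
    rcases hx with rfl | hx | hx
    · intro y hy
      simpa only [body, atoms, Finset.mem_union, Finset.mem_insert] using hy
    · exact fun y hy => .inr (.inl (ihφ hx hy))
    · exact fun y hy => .inr (.inr (ihψ hx hy))

/-- A family of pending obligations all of which are locally honoured. -/
def Closed (w : ℕ → Set V) (D : ℕ → Set (NNF V)) : Prop :=
  ∀ t, ∀ x ∈ D t, Eval (w t) (D (t + 1)) (body x)

theorem Closed.sat_of_eval {w : ℕ → Set V} {D : ℕ → Set (NNF V)} (hD : Closed w D)
    (hsu : ∀ᶠ t in atTop, ∀ x ∈ D t, ¬ IsSU x) {φ : NNF V} :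
    ∀ {t}, Eval (w t) (D (t + 1)) φ → Sat w φ t := by
  induction φ with
  | top | bot | pos | neg => exact fun h => h
  | and φ ψ ihφ ihψ => exact fun h => ⟨ihφ h.1, ihψ h.2⟩
  | or φ ψ ihφ ihψ => exact fun h => h.imp ihφ ihψ
  | next φ ih => exact fun h => ih (hD _ _ h)
  | su ψ φ ihψ ihφ =>
    intro t h
    obtain ⟨T, hT⟩ := eventually_atTop.1 hsu
    obtain ⟨d, hd⟩ : ∃ d, T ≤ t + d := ⟨T, by omega⟩
    induction d generalizing t with
    | zero =>
      rcases h with h | h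
      · exact ⟨t, le_rfl, ihψ h, fun j h1 h2 => by omega⟩
      · exact absurd trivial (hT (t + 1) (by omega) _ h.2)
    | succ d ih =>
      rcases h with h | h
      · exact ⟨t, le_rfl, ihψ h, fun j h1 h2 => by omega⟩
      · obtain ⟨k, hk, h1, h2⟩ := ih (hD _ _ h.2) (by omega)
        refine ⟨k, by omega, h1, fun j hj hjk => ?_⟩
        rcases hj.eq_or_lt with rfl | hj
        · exact ihφ h.1
        · exact h2 j hj hjk
  | rel χ γ ihχ ihγ =>
    intro t h k hk
    obtain ⟨d, rfl⟩ := Nat.exists_eq_add_of_le hk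
    clear hk
    induction d generalizing t with
    | zero => exact .inl (ihγ h.1)
    | succ d ih =>
      rcases h.2 with h' | h'
      · exact .inr ⟨t, le_rfl, by omega, ihχ h'⟩
      · have := ih (hD _ _ h')
        rw [show t + 1 + d = t + (d + 1) by omega] at this
        exact this.imp id fun ⟨j, h1, h2⟩ => ⟨j, by omega, h2⟩

theorem Closed.union {w : ℕ → Set V} {D D' : ℕ → Set (NNF V)} (h : Closed w D)
    (h' : Closed w D') : Closed w fun t => D t ∪ D' t := by
  rintro t x (hx | hx)
  · exact (h t x hx).mono Set.subset_union_left
  · exact (h' t x hx).mono Set.subset_union_right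

theorem Closed.insert {w : ℕ → Set V} {D : ℕ → Set (NNF V)} (h : Closed w D) {t : ℕ} {x : NNF V}
    (hx : Eval (w t) (D (t + 1)) (body x)) :
    Closed w fun s => D s ∪ {y | y = x ∧ s = t} := by
  rintro s y (hy | ⟨rfl, rfl⟩)
  · exact (h s y hy).mono Set.subset_union_left
  · exact hx.mono Set.subset_union_left

/-- `φ` can be honoured from position `t` on by obligations satisfying `P`. -/
def Honoured (P : (ℕ → Set (NNF V)) → Prop) (w : ℕ → Set V) (φ : NNF V) (t : ℕ) : Prop :=
  ∃ D, Closed w D ∧ P D ∧ Eval (w t) (D (t + 1)) φ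

theorem Honoured.and {P : (ℕ → Set (NNF V)) → Prop}
    (hP : ∀ D D', P D → P D' → P fun t => D t ∪ D' t) {w : ℕ → Set V} {φ ψ : NNF V} {t : ℕ}
    (h : Honoured P w φ t) (h' : Honoured P w ψ t) : Honoured P w (φ.and ψ) t := by
  obtain ⟨D, h1, h2, h3⟩ := h
  obtain ⟨D', h1', h2', h3'⟩ := h'
  exact ⟨_, h1.union h1', hP _ _ h2 h2', h3.mono Set.subset_union_left,
    h3'.mono Set.subset_union_right⟩

theorem Honoured.pending {P : (ℕ → Set (NNF V)) → Prop} {w : ℕ → Set V} {x : NNF V} {t : ℕ}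
    (hP : ∀ D, P D → P fun s => D s ∪ {y | y = x ∧ s = t + 1})
    (h : Honoured P w (body x) (t + 1)) :
    ∃ D, Closed w D ∧ P D ∧ x ∈ D (t + 1) := by
  obtain ⟨D, h1, h2, h3⟩ := h
  exact ⟨_, h1.insert h3, hP _ h2, .inr ⟨rfl, rfl⟩⟩

/-- No strong until is ever pending. -/
def NeverSU (D : ℕ → Set (NNF V)) : Prop := ∀ t, ∀ x ∈ D t, ¬ IsSU x

/-- From some position on no strong until is pending. -/
def FinallyNoSU (D : ℕ → Set (NNF V)) : Prop := ∀ᶠ t in atTop, ∀ x ∈ D t, ¬ IsSU x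

theorem NeverSU.union (D D' : ℕ → Set (NNF V)) (h : NeverSU D) (h' : NeverSU D') :
    NeverSU fun t => D t ∪ D' t := by
  rintro t x (hx | hx)
  · exact h t x hx
  · exact h' t x hx

theorem NeverSU.insert {x : NNF V} (hx : ¬ IsSU x) (t : ℕ) (D : ℕ → Set (NNF V))
    (h : NeverSU D) : NeverSU fun s => D s ∪ {y | y = x ∧ s = t} := by
  rintro s y (hy | ⟨rfl, -⟩)
  · exact h s y hy
  · exact hx

theorem FinallyNoSU.union (D D' : ℕ → Set (NNF V)) (h : FinallyNoSU D) (h' : FinallyNoSU D') :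
    FinallyNoSU fun t => D t ∪ D' t := by
  filter_upwards [h, h'] with t h1 h2
  rintro x (hx | hx)
  · exact h1 x hx
  · exact h2 x hx

theorem FinallyNoSU.insert (x : NNF V) (t : ℕ) (D : ℕ → Set (NNF V))
    (h : FinallyNoSU D) : FinallyNoSU fun s => D s ∪ {y | y = x ∧ s = t} := by
  filter_upwards [h, eventually_gt_atTop t] with s h1 hs
  rintro y (hy | ⟨-, rfl⟩)
  · exact h1 y hy
  · exact absurd hs (lt_irrefl _)

theorem Honoured.rel_of_eventually {P : (ℕ → Set (NNF V)) → Prop}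
    (hU : ∀ D D', P D → P D' → P fun t => D t ∪ D' t) {w : ℕ → Set V} {χ γ : NNF V}
    (hP : ∀ D t, P D → P fun s => D s ∪ {y | y = χ.rel γ ∧ s = t}) {t : ℕ} (d : ℕ)
    (hχ : Honoured P w χ (t + d))
    (hγ : ∀ j, t ≤ j → j ≤ t + d → Honoured P w γ j) : Honoured P w (χ.rel γ) t := by
  induction d generalizing t with
  | zero =>
    obtain ⟨D, h1, h2, h3, h4⟩ := Honoured.and hU (hγ t le_rfl le_rfl) hχ
    exact ⟨D, h1, h2, h3, .inl h4⟩
  | succ d ih =>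
    have hχ' : Honoured P w χ (t + 1 + d) := by rwa [show t + 1 + d = t + (d + 1) by omega]
    obtain ⟨D, h1, h2, h3⟩ := Honoured.pending (x := χ.rel γ) (fun D => hP D (t + 1))
      (ih hχ' fun j hj hj' => hγ j (by omega) (by omega))
    obtain ⟨D', h1', h2', h3'⟩ := hγ t le_rfl (by omega)
    exact ⟨_, h1.union h1', hU _ _ h2 h2', h3'.mono Set.subset_union_right, .inr (.inl h3)⟩

theorem Honoured.rel_of_forall {w : ℕ → Set V} {χ γ : NNF V} {t : ℕ}
    (hγ : ∀ j, Honoured NeverSU w γ (t + j)) : Honoured NeverSU w (χ.rel γ) t := by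
  choose D h1 h2 h3 using hγ
  have key : ∀ j, Eval (w (t + j)) ((⋃ i, D i (t + j + 1)) ∪ {y | y = χ.rel γ ∧ t < t + j + 1})
      (χ.rel γ) := fun j =>
    ⟨(h3 j).mono ((Set.subset_iUnion (fun i => D i (t + j + 1)) j).trans Set.subset_union_left),
      .inr (.inr ⟨rfl, by omega⟩)⟩
  refine ⟨fun s => (⋃ i, D i s) ∪ {y | y = χ.rel γ ∧ t < s}, ?_, ?_, key 0⟩
  · rintro s x (hx | ⟨rfl, hs⟩)
    · obtain ⟨i, hi⟩ := Set.mem_iUnion.1 hx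
      exact (h1 i s x hi).mono
        ((Set.subset_iUnion (fun i => D i (s + 1)) i).trans Set.subset_union_left)
    · obtain ⟨j, rfl⟩ := Nat.exists_eq_add_of_lt hs
      exact key (j + 1)
  · rintro s x (hx | ⟨rfl, -⟩)
    · obtain ⟨i, hi⟩ := Set.mem_iUnion.1 hx
      exact h2 i s x hi
    · exact id

theorem sat_rel_cases {w : ℕ → Set V} {χ γ : NNF V} {t : ℕ} (h : Sat w (χ.rel γ) t) :
    (∀ j, Sat w γ (t + j)) ∨
      ∃ d, Sat w χ (t + d) ∧ ∀ j, t ≤ j → j ≤ t + d → Sat w γ j := by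
  classical
  by_cases hex : ∃ d, Sat w χ (t + d)
  · refine .inr ⟨Nat.find hex, Nat.find_spec hex, fun j hj hj' => ?_⟩
    refine (h j hj).resolve_right ?_
    rintro ⟨i, hi, hij, hχ⟩
    obtain ⟨d, rfl⟩ := Nat.exists_eq_add_of_le hi
    exact Nat.find_min hex (by omega) hχ
  · refine .inl fun j => (h _ (by omega)).resolve_right ?_
    rintro ⟨i, hi, hij, hχ⟩
    obtain ⟨d, rfl⟩ := Nat.exists_eq_add_of_le hi
    exact hex ⟨d, hχ⟩

theorem Safe.honoured {w : ℕ → Set V} {φ : NNF V} (hφ : Safe φ) :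
    ∀ {t}, Sat w φ t → Honoured NeverSU w φ t := by
  have base : Closed w (fun _ => (∅ : Set (NNF V))) ∧ NeverSU (fun _ => (∅ : Set (NNF V))) :=
    ⟨fun _ _ h => h.elim, fun _ _ h => h.elim⟩
  induction φ with
  | top | bot | pos | neg => exact fun {t} h => ⟨_, base.1, base.2, h⟩
  | and φ ψ ihφ ihψ =>
    exact fun {t} h => Honoured.and NeverSU.union (ihφ hφ.1 h.1) (ihψ hφ.2 h.2)
  | or φ ψ ihφ ihψ =>
    rintro t (h | h)
    · obtain ⟨D, h1, h2, h3⟩ := ihφ hφ.1 h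
      exact ⟨D, h1, h2, .inl h3⟩
    · obtain ⟨D, h1, h2, h3⟩ := ihψ hφ.2 h
      exact ⟨D, h1, h2, .inr h3⟩
  | next φ ih =>
    exact fun {t} h => Honoured.pending (x := φ.next) (NeverSU.insert id _) (ih hφ h)
  | su ψ φ _ _ => exact hφ.elim
  | rel χ γ ihχ ihγ =>
    intro t h
    rcases sat_rel_cases h with h | ⟨d, h, h'⟩
    · exact Honoured.rel_of_forall fun j => ihγ hφ.2 (h j)
    · exact Honoured.rel_of_eventually NeverSU.union (fun D t => NeverSU.insert id t D) d
        (ihχ hφ.1 h) fun j hj hj' => ihγ hφ.2 (h' j hj hj')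

theorem Honoured.finally {w : ℕ → Set V} {φ : NNF V} {t : ℕ} (h : Honoured NeverSU w φ t) :
    Honoured FinallyNoSU w φ t := by
  obtain ⟨D, h1, h2, h3⟩ := h
  exact ⟨D, h1, .of_forall h2, h3⟩

theorem Persistent.honoured {w : ℕ → Set V} {φ : NNF V} (hφ : Persistent φ) :
    ∀ {t}, Sat w φ t → Honoured FinallyNoSU w φ t := by
  induction φ with
  | top | bot | pos | neg =>
    exact fun {t} h => Honoured.finally ⟨fun _ => ∅, fun _ _ h => h.elim, fun _ _ h => h.elim, h⟩
  | and φ ψ ihφ ihψ =>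
    exact fun {t} h => Honoured.and FinallyNoSU.union (ihφ hφ.1 h.1) (ihψ hφ.2 h.2)
  | or φ ψ ihφ ihψ =>
    rintro t (h | h)
    · obtain ⟨D, h1, h2, h3⟩ := ihφ hφ.1 h
      exact ⟨D, h1, h2, .inl h3⟩
    · obtain ⟨D, h1, h2, h3⟩ := ihψ hφ.2 h
      exact ⟨D, h1, h2, .inr h3⟩
  | next φ ih =>
    exact fun {t} h => Honoured.pending (x := φ.next) (FinallyNoSU.insert _ _) (ih hφ h)
  | su ψ φ ihψ ihφ =>
    rintro t ⟨k, hk, h, h'⟩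
    obtain ⟨d, rfl⟩ := Nat.exists_eq_add_of_le hk
    clear hk
    induction d generalizing t with
    | zero =>
      obtain ⟨D, h1, h2, h3⟩ := ihψ hφ.1 h
      exact ⟨D, h1, h2, .inl h3⟩
    | succ d ih =>
      obtain ⟨D, h1, h2, h3⟩ := Honoured.pending (x := ψ.su φ) (FinallyNoSU.insert _ (t + 1))
        (ih (by rwa [show t + 1 + d = t + (d + 1) by omega])
          fun j hj hj' => h' j (by omega) (by omega))
      obtain ⟨D', h1', h2', h3'⟩ := ihφ hφ.2 (h' t le_rfl (by omega))
      exact ⟨_, h1.union h1', FinallyNoSU.union _ _ h2 h2',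
        .inr ⟨h3'.mono Set.subset_union_right, .inl h3⟩⟩
  | rel χ γ ihχ ihγ =>
    intro t h
    rcases sat_rel_cases h with h | ⟨d, h, h'⟩
    · exact (Honoured.rel_of_forall fun j => hφ.2.honoured (h j)).finally
    · exact Honoured.rel_of_eventually FinallyNoSU.union (fun D t => FinallyNoSU.insert _ t D) d
        (ihχ hφ.1 h) fun j hj hj' => (hφ.2.honoured (h' j hj hj')).finally

/-- Acceptance of a word by the nondeterministic co-Büchi automaton whose states are the sets
of atoms of a persistent formula. -/
theorem Persistent.sat_iff_exists_run {φ : NNF V} (hφ : Persistent φ) (w : ℕ → Set V) :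
    Sat w φ 0 ↔ ∃ ρ : ℕ → Set φ.atoms, Eval (w 0) (Subtype.val '' ρ 0) φ ∧
      (∀ t, ∀ x ∈ ρ t, Eval (w (t + 1)) (Subtype.val '' ρ (t + 1)) (body x.1)) ∧
      ∀ᶠ t in atTop, ∀ x ∈ ρ t, ¬ IsSU x.1 := by
  constructor
  · intro h
    obtain ⟨D, h1, h2, h3⟩ := hφ.honoured h
    have himage : ∀ t, (Subtype.val '' {x : φ.atoms | x.1 ∈ D t}) = D t ∩ {x | x ∈ φ.atoms} := by
      intro t
      ext x
      simp [and_comm]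
    refine ⟨fun t => {x | x.1 ∈ D (t + 1)}, ?_, fun t x hx => ?_, ?_⟩
    · rw [himage]
      exact h3.inter_atoms fun x hx => hx
    · rw [himage]
      exact (h1 _ _ hx).inter_atoms fun y hy => atoms_body_subset x.2 hy
    · exact ((tendsto_add_atTop_nat 1).eventually h2).mono fun t ht x hx => ht _ hx
  · rintro ⟨ρ, h0, h1, h2⟩
    have hD : Closed w fun t => t.casesOn ∅ fun t => Subtype.val '' ρ t := by
      rintro (_ | t) x hx
      · exact hx.elim
      · obtain ⟨y, hy, rfl⟩ := hx
        exact h1 t y hy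
    refine hD.sat_of_eval ?_ h0
    obtain ⟨T, hT⟩ := eventually_atTop.1 h2
    refine eventually_atTop.2 ⟨T + 1, ?_⟩
    rintro (_ | t) ht x hx
    · omega
    · obtain ⟨y, hy, rfl⟩ := hx
      exact hT t (by omega) y hy

end NNF

section Breakpoint

variable {A K : Type}

open Classical in
/-- The breakpoint state with state set `S` and obligation set `S ∩ O`. -/
noncomputable def breakpointState (S O : K → Prop) : K → Option Bool :=
  fun k => if S k then some (decide (O k)) else none

theorem breakpointState_ne_none {S O : K → Prop} {k : K} :
    breakpointState S O k ≠ none ↔ S k := by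
  unfold breakpointState; split_ifs <;> simp_all

theorem breakpointState_eq_true {S O : K → Prop} {k : K} :
    breakpointState S O k = some true ↔ S k ∧ O k := by
  unfold breakpointState; split_ifs <;> simp_all

/-- The Miyano–Hayashi breakpoint transition function; `none` is the initial state. -/
noncomputable def breakpointStep (I : A → K → Prop) (R : K → A → K → Prop) (good : K → Prop) :
    Option (K → Option Bool) → A → Option (K → Option Bool)
  | none, a => some (breakpointState (I a) good)
  | some f, a => some (breakpointState (fun k' => ∃ k, f k ≠ none ∧ R k a k')
      fun k' => good k' ∧ ((∃ k, f k = some true) → ∃ k, f k = some true ∧ R k a k'))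

/-- An infinite path exists as soon as all its finite approximations do. -/
theorem exists_path_of_forall_finite_path [Finite K] (p : K → Prop) (q : ℕ → K → K → Prop)
    (h : ∀ n, ∃ ρ : ℕ → K, p (ρ 0) ∧ ∀ t < n, q t (ρ t) (ρ (t + 1))) :
    ∃ ρ : ℕ → K, p (ρ 0) ∧ ∀ t, q t (ρ t) (ρ (t + 1)) := by
  let _ : TopologicalSpace K := ⊥
  have : DiscreteTopology K := ⟨rfl⟩
  have hc : ∀ n, IsClosed {ρ : ℕ → K | p (ρ 0) ∧ ∀ t < n, q t (ρ t) (ρ (t + 1))} := by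
    intro n
    have h0 : IsClosed {ρ : ℕ → K | p (ρ 0)} :=
      (isClosed_discrete {k | p k}).preimage (continuous_apply 0)
    have h1 : ∀ t, IsClosed {ρ : ℕ → K | q t (ρ t) (ρ (t + 1))} := by
      intro t
      have hcont : Continuous fun ρ : ℕ → K => (ρ t, ρ (t + 1)) :=
        (continuous_apply t).prodMk (continuous_apply (t + 1))
      exact (isClosed_discrete {k : K × K | q t k.1 k.2}).preimage hcont
    have : {ρ : ℕ → K | p (ρ 0) ∧ ∀ t < n, q t (ρ t) (ρ (t + 1))} =
        {ρ | p (ρ 0)} ∩ ⋂ t, ⋂ (_ : t < n), {ρ | q t (ρ t) (ρ (t + 1))} := by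
      ext ρ; simp
    rw [this]
    exact h0.inter (isClosed_iInter fun t => isClosed_iInter fun _ => h1 t)
  obtain ⟨ρ, hρ⟩ := IsCompact.nonempty_iInter_of_sequence_nonempty_isCompact_isClosed
    (fun n => {ρ : ℕ → K | p (ρ 0) ∧ ∀ t < n, q t (ρ t) (ρ (t + 1))})
    (fun n ρ hρ => ⟨hρ.1, fun t ht => hρ.2 t (by omega)⟩) h (hc 0).isCompact hc
  rw [Set.mem_iInter] at hρ
  exact ⟨ρ, (hρ 0).1, fun t => (hρ (t + 1)).2 t (by omega)⟩

/-- Breakpoint determinization of nondeterministic co-Büchi automata. -/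
theorem breakpointStep_accepts_iff [Finite K] (I : A → K → Prop) (R : K → A → K → Prop)
    (good : K → Prop) (w : ℕ → A) :
    (∀ᶠ t in atTop, detRun (breakpointStep I R good) none w t ∈
        {s | ∃ f, s = some f ∧ ∃ k, f k = some true}) ↔
      ∃ ρ : ℕ → K, I (w 0) (ρ 0) ∧ (∀ t, R (ρ t) (w (t + 1)) (ρ (t + 1))) ∧
        ∀ᶠ t in atTop, good (ρ t) := by
  have hsome : ∀ t, ∃ f, detRun (breakpointStep I R good) none w (t + 1) = some f := by
    intro t
    rw [detRun]
    cases detRun (breakpointStep I R good) none w t <;> exact ⟨_, rfl⟩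
  choose f hf using hsome
  have hf0 : f 0 = breakpointState (I (w 0)) good := by
    have := hf 0
    simp only [detRun, breakpointStep, Option.some.injEq] at this
    exact this.symm
  have hfs : ∀ t, f (t + 1) = breakpointState (fun k' => ∃ k, f t k ≠ none ∧ R k (w (t + 1)) k')
      fun k' => good k' ∧ ((∃ k, f t k = some true) →
        ∃ k, f t k = some true ∧ R k (w (t + 1)) k') := by
    intro t
    have := hf (t + 1)
    rw [detRun, hf t] at this
    simp only [breakpointStep, Option.some.injEq] at this
    exact this.symm
  have hgood : ∀ t k, f t k = some true → good k := by
    rintro (_ | t) k hk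
    · rw [hf0, breakpointState_eq_true] at hk
      exact hk.2
    · rw [hfs, breakpointState_eq_true] at hk
      exact hk.2.1
  have hacc : (∀ᶠ t in atTop, detRun (breakpointStep I R good) none w t ∈
        {s | ∃ f, s = some f ∧ ∃ k, f k = some true}) ↔
      ∀ᶠ t in atTop, ∃ k, f t k = some true := by
    conv_lhs => rw [← map_add_atTop_eq_nat 1]
    simp [hf]
  rw [hacc]
  constructor
  · intro h
    obtain ⟨N, hN⟩ := eventually_atTop.1 h
    have hpath : ∀ n k, f n k ≠ none → ∃ ρ : ℕ → K, ρ n = k ∧ I (w 0) (ρ 0) ∧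
        ∀ t < n, R (ρ t) (w (t + 1)) (ρ (t + 1)) ∧
          (N ≤ t → f n k = some true → good (ρ t)) := by
      intro n
      induction n with
      | zero =>
        intro k hk
        rw [hf0, breakpointState_ne_none] at hk
        exact ⟨fun _ => k, rfl, hk, fun t ht => by omega⟩
      | succ n ih =>
        intro k' hk'
        obtain ⟨k, hk, hR, hgood'⟩ : ∃ k, f n k ≠ none ∧ R k (w (n + 1)) k' ∧
            (N ≤ n → f (n + 1) k' = some true → f n k = some true) := by
          by_cases hn : N ≤ n ∧ f (n + 1) k' = some true
          · have h1 := hn.2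
            rw [hfs, breakpointState_eq_true] at h1
            obtain ⟨k, hk, hR⟩ := h1.2.2 (hN n hn.1)
            exact ⟨k, by simp [hk], hR, fun _ _ => hk⟩
          · rw [hfs, breakpointState_ne_none] at hk'
            obtain ⟨k, hk, hR⟩ := hk'
            exact ⟨k, hk, hR, fun h1 h2 => absurd ⟨h1, h2⟩ hn⟩
        obtain ⟨ρ, rfl, h0, h1⟩ := ih k hk
        refine ⟨fun t => if t ≤ n then ρ t else k', by simp, by simpa using h0, fun t ht => ?_⟩
        rcases Nat.lt_succ_iff_lt_or_eq.1 ht with ht | rfl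
        · simp only [ht.le, Nat.succ_le_of_lt ht, if_true]
          exact ⟨(h1 t ht).1, fun h2 h3 => (h1 t ht).2 h2 (hgood' (by omega) h3)⟩
        · simp only [le_refl, if_true, show ¬ t + 1 ≤ t by omega, if_false]
          exact ⟨hR, fun h2 h3 => hgood t _ (hgood' h2 h3)⟩
    obtain ⟨ρ, h0, h1⟩ := exists_path_of_forall_finite_path (I (w 0))
      (fun t k k' => R k (w (t + 1)) k' ∧ (N ≤ t → good k)) (fun n => by
        obtain ⟨k, hk⟩ := hN (n + N) (by omega)
        obtain ⟨ρ, -, h0, h1⟩ := hpath (n + N) k (by simp [hk])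
        exact ⟨ρ, h0, fun t ht =>
          ⟨(h1 t (by omega)).1, fun h => (h1 t (by omega)).2 h hk⟩⟩)
    exact ⟨ρ, h0, fun t => (h1 t).1, eventually_atTop.2 ⟨N, fun t => (h1 t).2⟩⟩
  · rintro ⟨ρ, h0, h1, h2⟩
    obtain ⟨T, hT⟩ := eventually_atTop.1 h2
    have hS : ∀ t, f t (ρ t) ≠ none := by
      intro t
      induction t with
      | zero => rwa [hf0, breakpointState_ne_none]
      | succ t ih =>
        rw [hfs, breakpointState_ne_none]
        exact ⟨_, ih, h1 t⟩
    by_contra hcon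
    rw [not_eventually, frequently_atTop] at hcon
    obtain ⟨b, hb, hbreak⟩ := hcon T
    refine absurd (hcon (b + 1)) ?_
    push Not
    have : ∀ d, f (b + 1 + d) (ρ (b + 1 + d)) = some true := by
      intro d
      induction d with
      | zero =>
        rw [add_zero, hfs, breakpointState_eq_true]
        exact ⟨⟨_, hS b, h1 b⟩, hT _ (by omega), fun h => absurd h hbreak⟩
      | succ d ih =>
        rw [← add_assoc, hfs, breakpointState_eq_true]
        exact ⟨⟨_, hS _, h1 _⟩, hT _ (by omega), fun _ => ⟨_, ih, h1 _⟩⟩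
    intro t ht
    obtain ⟨d, rfl⟩ := Nat.exists_eq_add_of_le ht
    exact ⟨_, this d⟩

end Breakpoint

namespace NNF

variable {V : Type}

/-- The property `P` of positions is expressed by a negation normal form in the class `C` with
fewer than `n` temporal subformulas. -/
def Represented (C : NNF V → Prop) (P : (ℕ → Set V) → ℕ → Prop) (n : ℕ) : Prop :=
  ∃ φ, C φ ∧ (∀ w i, Sat w φ i ↔ P w i) ∧ φ.atoms.card + 1 ≤ n

namespace Represented

variable {C : NNF V → Prop} {P Q : (ℕ → Set V) → ℕ → Prop} {a b n : ℕ}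

theorem of_iff (h : Represented C P a) (han : a ≤ n) (hPQ : ∀ w i, P w i ↔ Q w i) :
    Represented C Q n := by
  obtain ⟨φ, h1, h2, h3⟩ := h
  exact ⟨φ, h1, fun w i => (h2 w i).trans (hPQ w i), h3.trans han⟩

theorem persistent (h : Represented Safe P a) : Represented Persistent P a := by
  obtain ⟨φ, h1, h2, h3⟩ := h
  exact ⟨φ, h1.persistent, h2, h3⟩

theorem top (hC : C .top) : Represented C (fun _ _ => True) 1 :=
  ⟨.top, hC, fun _ _ => Iff.rfl, by simp [atoms]⟩

theorem bot (hC : C .bot) : Represented C (fun _ _ => False) 1 :=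
  ⟨.bot, hC, fun _ _ => Iff.rfl, by simp [atoms]⟩

theorem pos (v : V) (hC : C (.pos v)) : Represented C (fun w i => v ∈ w i) 1 :=
  ⟨.pos v, hC, fun _ _ => Iff.rfl, by simp [atoms]⟩

theorem neg (v : V) (hC : C (.neg v)) : Represented C (fun w i => ¬ v ∈ w i) 1 :=
  ⟨.neg v, hC, fun _ _ => Iff.rfl, by simp [atoms]⟩

theorem and (hC : ∀ φ ψ, C φ → C ψ → C (.and φ ψ)) (hP : Represented C P a)
    (hQ : Represented C Q b) : Represented C (fun w i => P w i ∧ Q w i) (a + b) := by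
  classical
  obtain ⟨φ, h1, h2, h3⟩ := hP
  obtain ⟨ψ, h1', h2', h3'⟩ := hQ
  refine ⟨.and φ ψ, hC _ _ h1 h1', fun w i => and_congr (h2 w i) (h2' w i), ?_⟩
  have := Finset.card_union_le φ.atoms ψ.atoms
  simp only [atoms]
  convert_to (φ.atoms ∪ ψ.atoms).card + 1 ≤ a + b
  omega

theorem or (hC : ∀ φ ψ, C φ → C ψ → C (.or φ ψ)) (hP : Represented C P a)
    (hQ : Represented C Q b) : Represented C (fun w i => P w i ∨ Q w i) (a + b) := by
  classical
  obtain ⟨φ, h1, h2, h3⟩ := hP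
  obtain ⟨ψ, h1', h2', h3'⟩ := hQ
  refine ⟨.or φ ψ, hC _ _ h1 h1', fun w i => or_congr (h2 w i) (h2' w i), ?_⟩
  have := Finset.card_union_le φ.atoms ψ.atoms
  simp only [atoms]
  convert_to (φ.atoms ∪ ψ.atoms).card + 1 ≤ a + b
  omega

theorem next (hC : ∀ φ, C φ → C (.next φ)) (hP : Represented C P a) :
    Represented C (fun w i => P w (i + 1)) (a + 1) := by
  classical
  obtain ⟨φ, h1, h2, h3⟩ := hP
  refine ⟨.next φ, hC _ h1, fun w i => h2 w (i + 1), ?_⟩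
  have := Finset.card_insert_le φ.next φ.atoms
  simp only [atoms]
  convert_to (insert φ.next φ.atoms).card + 1 ≤ a + 1
  omega

theorem su (hP : Represented Persistent P a) (hQ : Represented Persistent Q b) :
    Represented Persistent
      (fun w i => ∃ k, i ≤ k ∧ P w k ∧ ∀ j, i ≤ j → j < k → Q w j) (a + b) := by
  classical
  obtain ⟨ψ, h1, h2, h3⟩ := hP
  obtain ⟨φ, h1', h2', h3'⟩ := hQ
  refine ⟨.su ψ φ, ⟨h1, h1'⟩, fun w i => by simp only [Sat, h2, h2'], ?_⟩
  have := Finset.card_insert_le (ψ.su φ) (ψ.atoms ∪ φ.atoms)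
  have := Finset.card_union_le ψ.atoms φ.atoms
  simp only [atoms]
  convert_to (insert (ψ.su φ) (ψ.atoms ∪ φ.atoms)).card + 1 ≤ a + b
  omega

theorem rel {D : NNF V → Prop} (hCD : ∀ χ γ, D χ → Safe γ → D (.rel χ γ))
    (hP : Represented D P a) (hQ : Represented Safe Q b) :
    Represented D
      (fun w i => ∀ k, i ≤ k → Q w k ∨ ∃ j, i ≤ j ∧ j < k ∧ P w j) (a + b) := by
  classical
  obtain ⟨χ, h1, h2, h3⟩ := hP
  obtain ⟨γ, h1', h2', h3'⟩ := hQ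
  refine ⟨.rel χ γ, hCD _ _ h1 h1', fun w i => by simp only [Sat, h2, h2'], ?_⟩
  have := Finset.card_insert_le (χ.rel γ) (χ.atoms ∪ γ.atoms)
  have := Finset.card_union_le χ.atoms γ.atoms
  simp only [atoms]
  convert_to (insert (χ.rel γ) (χ.atoms ∪ γ.atoms)).card + 1 ≤ a + b
  omega

theorem eventually (hP : Represented Persistent P a) :
    Represented Persistent (fun w i => ∃ k, i ≤ k ∧ P w k) (a + 1) :=
  (hP.su (top trivial)).of_iff le_rfl fun w i => by simp

theorem always (hP : Represented Safe P a) :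
    Represented Safe (fun w i => ∀ k, i ≤ k → P w k) (a + 1) :=
  (rel (fun _ _ => And.intro) (bot trivial) hP).of_iff (by omega) fun w i => by simp

/-- Weak until, expressed as `rel ψ (φ ∨ ψ)`. -/
theorem weakUntil (hP : Represented Safe P a) (hQ : Represented Safe Q b) :
    Represented Safe (fun w i => (∃ k, i ≤ k ∧ P w k ∧ ∀ j, i ≤ j → j < k → Q w j) ∨
      ∀ k, i ≤ k → Q w k) (a + b) := by
  classical
  obtain ⟨ψ, h1, h2, h3⟩ := hP
  obtain ⟨φ, h1', h2', h3'⟩ := hQ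
  refine ⟨.rel ψ (.or φ ψ), ⟨h1, h1', h1⟩, fun w i => ?_, ?_⟩
  · simp only [Sat, h2, h2']
    constructor
    · intro h
      by_cases hex : ∃ k, i ≤ k ∧ P w k
      · have hmin := fun j => Nat.find_min (H := hex) (m := j)
        obtain ⟨hk, hPk⟩ := Nat.find_spec hex
        refine .inl ⟨Nat.find hex, hk, hPk, fun j hj hjk => ?_⟩
        rcases h j hj with (h | h) | ⟨l, hl, hlj, h⟩
        · exact h
        · exact absurd ⟨hj, h⟩ (hmin j hjk)
        · exact absurd ⟨hl, h⟩ (hmin l (hlj.trans hjk))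
      · push Not at hex
        refine .inr fun k hk => ?_
        rcases h k hk with (h | h) | ⟨l, hl, -, h⟩
        · exact h
        · exact absurd h (hex k hk)
        · exact absurd h (hex l hl)
    · rintro (⟨k, hk, hPk, hQ⟩ | hQ) l hl
      · rcases lt_trichotomy l k with hlk | rfl | hkl
        · exact .inl (.inl (hQ l hl hlk))
        · exact .inl (.inr hPk)
        · exact .inr ⟨k, hk, hkl, hPk⟩
      · exact .inl (.inl (hQ l hl))
  · have := Finset.card_insert_le (ψ.rel (φ.or ψ)) (ψ.atoms ∪ φ.atoms)
    have := Finset.card_union_le ψ.atoms φ.atoms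
    simp only [atoms]
    convert_to (insert (ψ.rel (φ.or ψ)) (ψ.atoms ∪ (φ.atoms ∪ ψ.atoms))).card + 1 ≤ a + b
    rw [show ψ.atoms ∪ (φ.atoms ∪ ψ.atoms) = ψ.atoms ∪ φ.atoms by
      ext; simp only [Finset.mem_union]; tauto]
    omega

/-- Negated weak until, expressed as `su (¬φ ∧ ¬ψ) ¬ψ`. -/
theorem notWeakUntil (hP : Represented Persistent (fun w i => ¬ P w i) a)
    (hQ : Represented Persistent (fun w i => ¬ Q w i) b) :
    Represented Persistent (fun w i => ¬ ((∃ k, i ≤ k ∧ P w k ∧ ∀ j, i ≤ j → j < k → Q w j) ∨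
      ∀ k, i ≤ k → Q w k)) (a + b) := by
  classical
  obtain ⟨ψ, h1, h2, h3⟩ := hP
  obtain ⟨φ, h1', h2', h3'⟩ := hQ
  refine ⟨.su (.and φ ψ) ψ, ⟨⟨h1', h1⟩, h1⟩, fun w i => ?_, ?_⟩
  · simp only [Sat, h2, h2']
    constructor
    · rintro ⟨k, hk, ⟨hQk, hPk⟩, hP⟩ (⟨l, hl, hPl, hQ⟩ | hQ)
      · rcases lt_trichotomy l k with hlk | rfl | hkl
        · exact hP l hl hlk hPl
        · exact hPk hPl
        · exact hQk (hQ k hk hkl)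
      · exact hQk (hQ k hk)
    · intro h
      push Not at h
      obtain ⟨h, hex⟩ := h
      have hmin := fun j => Nat.find_min (H := hex) (m := j)
      obtain ⟨hk, hQk⟩ := Nat.find_spec hex
      have hQ : ∀ j, i ≤ j → j < Nat.find hex → Q w j := fun j hj hjk => by
        by_contra hQj
        exact hmin j hjk ⟨hj, hQj⟩
      have hP : ∀ j, i ≤ j → j ≤ Nat.find hex → ¬ P w j := fun j hj hjk hPj => by
        obtain ⟨l, hl, hlj, hQl⟩ := h j hj hPj
        exact hQl (hQ l hl (hlj.trans_le hjk))
      exact ⟨_, hk, ⟨hQk, hP _ hk le_rfl⟩, fun j hj hjk => hP j hj hjk.le⟩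
  · have := Finset.card_insert_le ((φ.and ψ).su ψ) (φ.atoms ∪ ψ.atoms)
    have := Finset.card_union_le φ.atoms ψ.atoms
    simp only [atoms]
    convert_to (insert ((φ.and ψ).su ψ) (φ.atoms ∪ ψ.atoms ∪ ψ.atoms)).card + 1 ≤ a + b
    rw [Finset.union_assoc, Finset.union_self]
    omega

end Represented

end NNF

namespace LTL

variable {V : Type}

open NNF (Represented Safe Persistent)

theorem sat_land {w : ℕ → Set V} {φ ψ : LTL V} {i : ℕ} :
    Sat w (land φ ψ) i ↔ Sat w φ i ∧ Sat w ψ i := by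
  simp only [land, Sat]; tauto

theorem sat_lF {w : ℕ → Set V} {φ : LTL V} {i : ℕ} :
    Sat w (lF φ) i ↔ ∃ k, i ≤ k ∧ Sat w φ k := by
  simp [lF, Sat]

theorem sat_lG {w : ℕ → Set V} {φ : LTL V} {i : ℕ} :
    Sat w (lG φ) i ↔ ∀ k, i ≤ k → Sat w φ k := by
  simp [lG, lF, Sat]

theorem sat_lwu {w : ℕ → Set V} {ψ φ : LTL V} {i : ℕ} :
    Sat w (lwu ψ φ) i ↔ (∃ k, i ≤ k ∧ Sat w ψ k ∧ ∀ j, i ≤ j → j < k → Sat w φ j) ∨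
      ∀ k, i ≤ k → Sat w φ k := by
  rw [← sat_lG]; simp only [lwu, Sat]

theorem represented_not_lsu {C : NNF V → Prop} {ψ φ : LTL V} {a b : ℕ}
    (hC : ∀ χ γ, C χ → Safe γ → C (.rel χ γ))
    (hφ : Represented C (fun w i => ¬ Sat w φ i) b)
    (hψ : Represented Safe (fun w i => ¬ Sat w ψ i) a) :
    Represented C (fun w i => ¬ Sat w (lsu ψ φ) i) (a + b) :=
  (hφ.rel hC hψ).of_iff (by omega) fun w i => by
    simp only [Sat]
    push Not
    exact forall_congr' fun k => forall_congr' fun _ => by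
      simp only [imp_iff_not_or]

mutual

theorem TLG.represented : ∀ {Φ : LTL V}, TLG Φ →
    Represented Safe (fun w i => Sat w Φ i) Φ.size ∧
      Represented Persistent (fun w i => ¬ Sat w Φ i) Φ.size
  | _, .var v => ⟨.pos v trivial, .neg v trivial⟩
  | _, .not h =>
    have ih := TLF.represented h
    ⟨ih.2.of_iff (by simp [size]) fun w i => by simp [Sat],
      ih.1.of_iff (by simp [size]) fun w i => by simp [Sat]⟩
  | _, .and h h' =>
    have ih := TLG.represented h
    have ih' := TLG.represented h'
    ⟨(ih.1.and (fun _ _ => And.intro) ih'.1).of_iff (by simp only [land, size]; omega)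
        fun w i => by rw [sat_land],
      (ih.2.or (fun _ _ => And.intro) ih'.2).of_iff (by simp only [land, size]; omega)
        fun w i => by rw [sat_land]; tauto⟩
  | _, .or h h' =>
    have ih := TLG.represented h
    have ih' := TLG.represented h'
    ⟨(ih.1.or (fun _ _ => And.intro) ih'.1).of_iff (by simp only [size]; omega)
        fun w i => by rw [Sat],
      (ih.2.and (fun _ _ => And.intro) ih'.2).of_iff (by simp only [size]; omega)
        fun w i => by rw [Sat]; tauto⟩
  | _, .next h =>
    have ih := TLG.represented h
    ⟨ih.1.next fun _ => id, ih.2.next fun _ => id⟩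
  | _, .alw h =>
    have ih := TLG.represented h
    ⟨ih.1.always.of_iff (by simp only [lG, lF, size]; omega) fun w i => by rw [sat_lG],
      ih.2.eventually.of_iff (by simp only [lG, lF, size]; omega)
        fun w i => by rw [sat_lG]; push Not; rfl⟩
  | _, .wu h h' =>
    have ih := TLG.represented h
    have ih' := TLG.represented h'
    ⟨(ih.1.weakUntil ih'.1).of_iff (by simp only [lwu, lG, lF, size]; omega)
        fun w i => by rw [sat_lwu],
      (ih.2.notWeakUntil ih'.2).of_iff (by simp only [lwu, lG, lF, size]; omega)
        fun w i => by rw [sat_lwu]⟩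

theorem TLF.represented : ∀ {Φ : LTL V}, TLF Φ →
    Represented Persistent (fun w i => Sat w Φ i) Φ.size ∧
      Represented Safe (fun w i => ¬ Sat w Φ i) Φ.size
  | _, .var v => ⟨.pos v trivial, .neg v trivial⟩
  | _, .not h =>
    have ih := TLG.represented h
    ⟨ih.2.of_iff (by simp [size]) fun w i => by simp [Sat],
      ih.1.of_iff (by simp [size]) fun w i => by simp [Sat]⟩
  | _, .and h h' =>
    have ih := TLF.represented h
    have ih' := TLF.represented h'
    ⟨(ih.1.and (fun _ _ => And.intro) ih'.1).of_iff (by simp only [land, size]; omega)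
        fun w i => by rw [sat_land],
      (ih.2.or (fun _ _ => And.intro) ih'.2).of_iff (by simp only [land, size]; omega)
        fun w i => by rw [sat_land]; tauto⟩
  | _, .or h h' =>
    have ih := TLF.represented h
    have ih' := TLF.represented h'
    ⟨(ih.1.or (fun _ _ => And.intro) ih'.1).of_iff (by simp only [size]; omega)
        fun w i => by rw [Sat],
      (ih.2.and (fun _ _ => And.intro) ih'.2).of_iff (by simp only [size]; omega)
        fun w i => by rw [Sat]; tauto⟩
  | _, .next h =>
    have ih := TLF.represented h
    ⟨ih.1.next fun _ => id, ih.2.next fun _ => id⟩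
  | _, .ev h =>
    have ih := TLF.represented h
    ⟨ih.1.eventually.of_iff (by simp only [lF, size]; omega) fun w i => by rw [sat_lF],
      ih.2.always.of_iff (by simp only [lF, size]; omega)
        fun w i => by rw [sat_lF]; push Not; rfl⟩
  | _, .su h h' =>
    have ih := TLF.represented h
    have ih' := TLF.represented h'
    ⟨(ih.1.su ih'.1).of_iff (by simp only [size]; omega) fun w i => by rw [Sat],
      (represented_not_lsu (fun _ _ => And.intro) ih'.2 ih.2).of_iff
        (by simp only [size]; omega) fun w i => Iff.rfl⟩

end

theorem TLPrefix.represented {Φ : LTL V} (hΦ : TLPrefix Φ) :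
    Represented Persistent (fun w i => Sat w Φ i) Φ.size ∧
      Represented Persistent (fun w i => ¬ Sat w Φ i) Φ.size := by
  induction hΦ with
  | g h => exact ⟨h.represented.1.persistent, h.represented.2⟩
  | f h => exact ⟨h.represented.1, h.represented.2.persistent⟩
  | not _ ih =>
    exact ⟨ih.2.of_iff (by simp [size]) fun w i => by simp [Sat],
      ih.1.of_iff (by simp [size]) fun w i => by simp [Sat]⟩
  | and _ _ ih ih' =>
    exact ⟨(ih.1.and (fun _ _ => And.intro) ih'.1).of_iff (by simp only [land, size]; omega)
        fun w i => by rw [sat_land],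
      (ih.2.or (fun _ _ => And.intro) ih'.2).of_iff (by simp only [land, size]; omega)
        fun w i => by rw [sat_land]; tauto⟩
  | or _ _ ih ih' =>
    exact ⟨(ih.1.or (fun _ _ => And.intro) ih'.1).of_iff (by simp only [size]; omega)
        fun w i => by rw [Sat],
      (ih.2.and (fun _ _ => And.intro) ih'.2).of_iff (by simp only [size]; omega)
        fun w i => by rw [Sat]; tauto⟩

mutual

theorem TLGF.represented : ∀ {Φ : LTL V}, TLGF Φ →
    Represented Persistent (fun w i => ¬ Sat w Φ i) Φ.size
  | _, .pre h => h.represented.2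
  | _, .not h => (TLFG.represented h).of_iff (by simp [size]) fun w i => by simp [Sat]
  | _, .and h h' =>
    ((TLGF.represented h).or (fun _ _ => And.intro) (TLGF.represented h')).of_iff
      (by simp only [land, size]; omega) fun w i => by rw [sat_land]; tauto
  | _, .or h h' =>
    ((TLGF.represented h).and (fun _ _ => And.intro) (TLGF.represented h')).of_iff
      (by simp only [size]; omega) fun w i => by rw [Sat]; tauto
  | _, .next h => (TLGF.represented h).next fun _ => id
  | _, .alw h =>
    (TLGF.represented h).eventually.of_iff (by simp only [lG, lF, size]; omega)
      fun w i => by rw [sat_lG]; push Not; rfl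
  | _, .wu h h' =>
    ((TLGF.represented h).notWeakUntil (TLGF.represented h')).of_iff
      (by simp only [lwu, lG, lF, size]; omega) fun w i => by rw [sat_lwu]
  | _, .suF h h' =>
    (represented_not_lsu (fun _ _ => And.intro) (TLGF.represented h') h.represented.2).of_iff
      (by simp only [size]; omega) fun w i => Iff.rfl

theorem TLFG.represented : ∀ {Φ : LTL V}, TLFG Φ →
    Represented Persistent (fun w i => Sat w Φ i) Φ.size
  | _, .pre h => h.represented.1
  | _, .not h => (TLGF.represented h).of_iff (by simp [size]) fun w i => by simp [Sat]
  | _, .and h h' =>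
    ((TLFG.represented h).and (fun _ _ => And.intro) (TLFG.represented h')).of_iff
      (by simp only [land, size]; omega) fun w i => by rw [sat_land]
  | _, .or h h' =>
    ((TLFG.represented h).or (fun _ _ => And.intro) (TLFG.represented h')).of_iff
      (by simp only [size]; omega) fun w i => by rw [Sat]
  | _, .next h => (TLFG.represented h).next fun _ => id
  | _, .ev h =>
    (TLFG.represented h).eventually.of_iff (by simp only [lF, size]; omega)
      fun w i => by rw [sat_lF]
  | _, .su h h' =>
    ((TLFG.represented h).su (TLFG.represented h')).of_iff (by simp only [size]; omega)
      fun w i => by rw [Sat]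
  | _, .wuG h h' =>
    (((TLFG.represented h).su h'.represented.1.persistent).or (fun _ _ => And.intro)
      h'.represented.1.always.persistent).of_iff (by simp only [lwu, lG, lF, size]; omega)
      fun w i => by rw [sat_lwu]

end

end LTL

section Streett

variable {A : Type}

/-- `L` is recognized by a deterministic automaton with at most `2 ^ B` states whose acceptance
condition depends only on which of `m + 1` state sets are visited infinitely often. -/
def EmersonLeiRecognizable (L : (ℕ → A) → Prop) (m B : ℕ) : Prop :=
  ∃ (S : Type) (_ : Fintype S) (s0 : S) (δ : S → A → S) (ι : Type) (_ : Fintype ι)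
    (F : ι → Set S) (acc : Set ι → Prop),
    Fintype.card ι = m + 1 ∧ Fintype.card S ≤ 2 ^ B ∧
      ∀ w, acc {i | ∃ᶠ t in atTop, detRun δ s0 w t ∈ F i} ↔ L w

namespace EmersonLeiRecognizable

variable {L L' : (ℕ → A) → Prop} {m m' B B' : ℕ}

theorem mono (h : EmersonLeiRecognizable L m B) (hB : B ≤ B') :
    EmersonLeiRecognizable L m B' := by
  obtain ⟨S, iS, s0, δ, ι, iι, F, acc, h1, h2, h3⟩ := h
  exact ⟨S, iS, s0, δ, ι, iι, F, acc, h1, h2.trans (Nat.pow_le_pow_right two_pos hB), h3⟩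

theorem congr (h : EmersonLeiRecognizable L m B) (hL : ∀ w, L w ↔ L' w) :
    EmersonLeiRecognizable L' m B := by
  obtain ⟨S, iS, s0, δ, ι, iι, F, acc, h1, h2, h3⟩ := h
  exact ⟨S, iS, s0, δ, ι, iι, F, acc, h1, h2, fun w => (h3 w).trans (hL w)⟩

theorem not (h : EmersonLeiRecognizable L m B) :
    EmersonLeiRecognizable (fun w => ¬ L w) m B := by
  obtain ⟨S, iS, s0, δ, ι, iι, F, acc, h1, h2, h3⟩ := h
  exact ⟨S, iS, s0, δ, ι, iι, F, fun T => ¬ acc T, h1, h2, fun w => not_congr (h3 w)⟩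

theorem or (h : EmersonLeiRecognizable L m B) (h' : EmersonLeiRecognizable L' m' B') :
    EmersonLeiRecognizable (fun w => L w ∨ L' w) (m + m' + 1) (B + B') := by
  obtain ⟨S, iS, s0, δ, ι, iι, F, acc, h1, h2, h3⟩ := h
  obtain ⟨S', iS', s0', δ', ι', iι', F', acc', h1', h2', h3'⟩ := h'
  have hrun : ∀ w t, detRun (fun (s : S × S') a => (δ s.1 a, δ' s.2 a)) (s0, s0') w t =
      (detRun δ s0 w t, detRun δ' s0' w t) := by
    intro w t
    induction t with
    | zero => rfl
    | succ t ih => simp only [detRun, ih]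
  refine ⟨S × S', inferInstance, (s0, s0'), fun s a => (δ s.1 a, δ' s.2 a), ι ⊕ ι',
    inferInstance, Sum.elim (fun i => {s | s.1 ∈ F i}) fun i => {s | s.2 ∈ F' i},
    fun T => acc {i | .inl i ∈ T} ∨ acc' {i | .inr i ∈ T}, ?_, ?_, fun w => ?_⟩
  · rw [Fintype.card_sum, h1, h1']; omega
  · rw [Fintype.card_prod, pow_add]
    exact Nat.mul_le_mul h2 h2'
  · simp only [hrun, Set.mem_ofPred_eq, Sum.elim_inl, Sum.elim_inr, h3, h3']

open Fin.CommRing in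
/-- A cyclic counter that is incremented infinitely often is incremented infinitely often at
each of its values. -/
theorem frequently_counter_eq {c : ℕ → Fin (m + 1)} {p : ℕ → Prop}
    (h0 : ∀ t, ¬ p t → c (t + 1) = c t) (h1 : ∀ t, p t → c (t + 1) = c t + 1)
    (hp : ∃ᶠ t in atTop, p t) (i : Fin (m + 1)) : ∃ᶠ t in atTop, p t ∧ c t = i := by
  classical
  obtain ⟨i₀, hi₀⟩ : ∃ i₀, ∃ᶠ t in atTop, p t ∧ c t = i₀ := by
    by_contra hcon
    simp only [not_exists, not_frequently] at hcon
    refine hp ((eventually_all.2 hcon).mono fun t ht hpt => ht (c t) ⟨hpt, rfl⟩)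
  have hstep : ∀ i, (∃ᶠ t in atTop, p t ∧ c t = i) → ∃ᶠ t in atTop, p t ∧ c t = i + 1 := by
    intro i hi
    rw [frequently_atTop] at hi hp ⊢
    intro N
    obtain ⟨t, ht, hpt, rfl⟩ := hi N
    have hex : ∃ d, p (t + 1 + d) := by
      obtain ⟨u, hu, hpu⟩ := hp (t + 1)
      obtain ⟨d, rfl⟩ := Nat.exists_eq_add_of_le hu
      exact ⟨d, hpu⟩
    have hconst : ∀ d ≤ Nat.find hex, c (t + 1 + d) = c t + 1 := by
      intro d
      induction d with
      | zero => exact fun _ => h1 t hpt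
      | succ d ih =>
        intro hd
        rw [← add_assoc, h0 _ (Nat.find_min hex (by omega)), ih (by omega)]
    exact ⟨_, by omega, Nat.find_spec hex, hconst _ le_rfl⟩
  have hall : ∀ d : ℕ, ∃ᶠ t in atTop, p t ∧ c t = i₀ + (d : Fin (m + 1)) := by
    intro d
    induction d with
    | zero => simpa using hi₀
    | succ d ih => simpa [add_assoc] using hstep _ ih
  simpa using hall (i - i₀ : Fin (m + 1)).val

open Classical in
theorem exists_streett {e : ℕ} (h : EmersonLeiRecognizable L m (2 ^ e)) (hme : m + 1 ≤ e) :
    ∃ (S : Type) (_ : Fintype S) (s0 : S) (δ : S → A → S) (f : ℕ) (Fs Es : Fin (f + 1) → Set S),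
      Fintype.card S ≤ 2 ^ 2 ^ (e + m) ∧
      ∀ w, (∀ j, (∃ᶠ t in atTop, detRun δ s0 w t ∈ Fs j) ∨
        ∀ᶠ t in atTop, detRun δ s0 w t ∈ Es j) ↔ L w := by
  obtain ⟨S, iS, s0, δ, ι, iι, F, acc, h1, h2, h3⟩ := h
  have eqv : Fin (m + 1) ≃ ι := (Fintype.equivFinOfCardEq h1).symm
  let adv : Set ι → S × (Set ι → Fin (m + 1)) → Prop := fun T s =>
    eqv (s.2 T) ∉ T ∨ s.1 ∈ F (eqv (s.2 T))
  let δ' : S × (Set ι → Fin (m + 1)) → A → S × (Set ι → Fin (m + 1)) := fun s a =>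
    (δ s.1 a, fun T => if adv T s then s.2 T + 1 else s.2 T)
  have hcard : Fintype.card (Set ι) = (2 ^ (m + 1) - 1) + 1 := by
    rw [Fintype.card_set, h1]
    have := Nat.one_le_two_pow (n := m + 1)
    omega
  let idx : Fin (2 ^ (m + 1) - 1 + 1) ≃ Set ι := (Fintype.equivFinOfCardEq hcard).symm
  refine ⟨S × (Set ι → Fin (m + 1)), inferInstance, (s0, fun _ => 0), δ', 2 ^ (m + 1) - 1,
    fun j => {s | acc (idx j) ∨ ∃ i, i ∉ idx j ∧ s.1 ∈ F i}, fun j => {s | ¬ adv (idx j) s},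
    ?_, fun w => ?_⟩
  · rw [Fintype.card_prod, Fintype.card_fun, Fintype.card_set, Fintype.card_fin, h1]
    have hm : m + 1 ≤ 2 ^ m := Nat.lt_two_pow_self
    calc Fintype.card S * (m + 1) ^ 2 ^ (m + 1)
        ≤ 2 ^ 2 ^ e * (2 ^ m) ^ 2 ^ (m + 1) :=
          Nat.mul_le_mul h2 (Nat.pow_le_pow_left hm _)
      _ = 2 ^ (2 ^ e + m * 2 ^ (m + 1)) := by rw [← pow_mul, ← pow_add]
      _ ≤ 2 ^ 2 ^ (e + m) := by
        refine Nat.pow_le_pow_right two_pos ?_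
        have h4 : 2 ^ (m + 1) ≤ 2 ^ e := Nat.pow_le_pow_right two_pos hme
        calc 2 ^ e + m * 2 ^ (m + 1) ≤ 2 ^ e + m * 2 ^ e := by gcongr
          _ = 2 ^ e * (m + 1) := by ring
          _ ≤ 2 ^ e * 2 ^ m := by gcongr
          _ = 2 ^ (e + m) := (pow_add _ _ _).symm
  · set r := detRun δ' (s0, fun _ => 0) w with hr
    have hfst : ∀ t, (r t).1 = detRun δ s0 w t := by
      intro t
      induction t with
      | zero => rfl
      | succ t ih => simp only [hr, detRun, δ'] at ih ⊢; rw [ih]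
    set U : Set ι := {i | ∃ᶠ t in atTop, detRun δ s0 w t ∈ F i} with hU
    have hadv : ∀ T, (∃ᶠ t in atTop, adv T (r t)) ↔ T ⊆ U := by
      intro T
      have h0 : ∀ t, ¬ adv T (r t) → (r (t + 1)).2 T = (r t).2 T := fun t ht => by
        simp only [hr, detRun, δ'] at ht ⊢
        rw [if_neg ht]
      have h1 : ∀ t, adv T (r t) → (r (t + 1)).2 T = (r t).2 T + 1 := fun t ht => by
        simp only [hr, detRun, δ'] at ht ⊢
        rw [if_pos ht]
      constructor
      · intro hp i hi
        refine (frequently_counter_eq (c := fun t => (r t).2 T) h0 h1 hp (eqv.symm i)).mono ?_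
        rintro t ⟨ht, hct⟩
        rw [← hfst]
        simp only [adv, hct, Equiv.apply_symm_apply] at ht
        exact ht.resolve_left (not_not.2 hi)
      · intro hTU hcon
        obtain ⟨N, hN⟩ := eventually_atTop.1 hcon
        have hconst : ∀ d, (r (N + d)).2 T = (r N).2 T := by
          intro d
          induction d with
          | zero => rfl
          | succ d ih => rw [← add_assoc, h0 _ (hN _ (by omega)), ih]
        have hmem : eqv ((r N).2 T) ∈ T := by
          by_contra hmem
          exact hN N le_rfl (.inl hmem)
        obtain ⟨t, ht, hF⟩ := frequently_atTop.1 (hTU hmem) N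
        obtain ⟨d, rfl⟩ := Nat.exists_eq_add_of_le ht
        refine hN _ ht (.inr ?_)
        rw [hconst, hfst]
        exact hF
    have hvisit : ∀ T, (∃ᶠ t in atTop, ∃ i, i ∉ T ∧ (r t).1 ∈ F i) ↔ ¬ U ⊆ T := by
      intro T
      simp only [hfst, Set.not_subset]
      constructor
      · intro hf
        by_contra hcon
        push Not at hcon
        refine hf ?_
        have : ∀ i, ∀ᶠ t in atTop, ¬ (i ∉ T ∧ detRun δ s0 w t ∈ F i) := by
          intro i
          by_cases hi : i ∈ T
          · exact .of_forall fun t ht => ht.1 hi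
          · have : i ∉ U := fun hiU => hi (hcon i hiU)
            exact (not_frequently.1 this).mono fun t ht h => ht h.2
        exact (eventually_all.2 this).mono fun t ht ⟨i, hi⟩ => ht i hi
      · rintro ⟨i, hiU, hiT⟩
        exact Frequently.mono hiU fun t ht => ⟨i, hiT, ht⟩
    have hpair : ∀ T, ((∃ᶠ t in atTop, acc T ∨ ∃ i, i ∉ T ∧ (r t).1 ∈ F i) ∨
        ∀ᶠ t in atTop, ¬ adv T (r t)) ↔ (U = T → acc T) := by
      intro T
      rw [frequently_or_distrib, hvisit, ← not_frequently, hadv, frequently_const,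
        Set.Subset.antisymm_iff]
      tauto
    rw [← h3 w]
    constructor
    · intro hall
      have := hall (idx.symm U)
      simp only [Set.mem_ofPred_eq, Equiv.apply_symm_apply] at this
      exact (hpair U).1 this rfl
    · intro hacc j
      exact (hpair (idx j)).2 fun h => h ▸ hacc

end EmersonLeiRecognizable

end Streett

namespace LTL

variable {V : Type}

theorem size_pos (Φ : LTL V) : 1 ≤ Φ.size := by
  cases Φ <;> simp [size]

theorem _root_.NNF.Represented.recognizable {P : (ℕ → Set V) → ℕ → Prop} {n : ℕ}
    (h : NNF.Represented NNF.Persistent P n) :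
    EmersonLeiRecognizable (fun w => P w 0) 0 (2 ^ n) := by
  classical
  obtain ⟨φ, h1, h2, h3⟩ := h
  let good : Set φ.atoms → Prop := fun k => ∀ x ∈ k, ¬ NNF.IsSU x.1
  let I : Set V → Set φ.atoms → Prop := fun a k => NNF.Eval a (Subtype.val '' k) φ
  let R : Set φ.atoms → Set V → Set φ.atoms → Prop := fun k a k' =>
    ∀ x ∈ k, NNF.Eval a (Subtype.val '' k') (NNF.body x.1)
  refine ⟨Option (Set φ.atoms → Option Bool), inferInstance, none, breakpointStep I R good,
    Unit, inferInstance, fun _ => {s | ∃ f, s = some f ∧ ∃ k, f k = some true}ᶜ,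
    fun T => () ∉ T, rfl, ?_, fun w => ?_⟩
  · simp only [Fintype.card_option, Fintype.card_fun, Fintype.card_set, Fintype.card_coe,
      Fintype.card_bool]
    have h4 : 2 * 2 ^ φ.atoms.card ≤ 2 ^ n := by
      rw [← pow_succ']
      exact Nat.pow_le_pow_right two_pos h3
    calc (2 + 1) ^ 2 ^ φ.atoms.card + 1 ≤ (2 + 1 + 1) ^ 2 ^ φ.atoms.card :=
          Nat.succ_le_of_lt (Nat.pow_lt_pow_left (by omega) (by positivity))
      _ = 2 ^ (2 * 2 ^ φ.atoms.card) := by rw [pow_mul]; norm_num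
      _ ≤ 2 ^ 2 ^ n := Nat.pow_le_pow_right two_pos h4
  · change () ∉ _ ↔ P w 0
    rw [← h2, h1.sat_iff_exists_run, Set.mem_ofPred_eq, not_frequently]
    simp only [Set.mem_compl_iff, not_not]
    exact breakpointStep_accepts_iff I R good w

theorem TLStreett.recognizable {Φ : LTL V} (hΦ : TLStreett Φ) :
    ∃ m e, EmersonLeiRecognizable (fun w => Sat w Φ 0) m (2 ^ e) ∧
      m + 1 ≤ e ∧ e + m ≤ Φ.size := by
  have hor : ∀ {L L' : (ℕ → Set V) → Prop} {m m' e e' : ℕ}, m + 1 ≤ e → m' + 1 ≤ e' →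
      EmersonLeiRecognizable L m (2 ^ e) → EmersonLeiRecognizable L' m' (2 ^ e') →
      EmersonLeiRecognizable (fun w => L w ∨ L' w) (m + m' + 1) (2 ^ (e + e')) := by
    intro L L' m m' e e' he he' h h'
    refine (h.or h').mono ?_
    rw [pow_add]
    exact Nat.add_le_mul (Nat.le_self_pow (by omega) 2) (Nat.le_self_pow (by omega) 2)
  induction hΦ with
  | @gf Φ h =>
    exact ⟨0, Φ.size, h.represented.recognizable.not.congr fun w => not_not,
      size_pos Φ, le_rfl⟩
  | @fg Φ h => exact ⟨0, Φ.size, h.represented.recognizable, size_pos Φ, le_rfl⟩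
  | not _ ih =>
    obtain ⟨m, e, h1, h2, h3⟩ := ih
    exact ⟨m, e, h1.not, h2, by simp only [size]; omega⟩
  | and _ _ ih ih' =>
    obtain ⟨m, e, h1, h2, h3⟩ := ih
    obtain ⟨m', e', h1', h2', h3'⟩ := ih'
    exact ⟨m + m' + 1, e + e', (hor h2 h2' h1.not h1'.not).not, by omega,
      by simp only [land, size]; omega⟩
  | or _ _ ih ih' =>
    obtain ⟨m, e, h1, h2, h3⟩ := ih
    obtain ⟨m', e', h1', h2', h3'⟩ := ih'
    exact ⟨m + m' + 1, e + e', hor h2 h2' h1 h1', by omega, by simp only [size]; omega⟩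

end LTL

/-- every `TL_Streett` formula `Φ` is recognized by a deterministic
ω-automaton with a Streett acceptance condition (pairs `(Fs j, Es j)`, `j = 0,…,f`:
the run visits `Fs j` infinitely often or stays in `Es j` from some point on,
for every `j`) and at most `2 ^ 2 ^ |Φ|` states. -/
theorem tlStreett_deterministic_streett_automaton
    {V : Type} [Fintype V] (Φ : LTL V) (hΦ : LTL.TLStreett Φ) :
    ∃ (S : Type) (_ : Fintype S) (s0 : S) (δ : S → Set V → S) (f : ℕ)
      (Fs Es : Fin (f + 1) → Set S),
      Fintype.card S ≤ 2 ^ (2 ^ LTL.size Φ) ∧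
      ∀ w : ℕ → Set V,
        ((∀ j, (∀ N, ∃ t, N ≤ t ∧ detRun δ s0 w t ∈ Fs j)
              ∨ (∃ N, ∀ t, N ≤ t → detRun δ s0 w t ∈ Es j))
          ↔ LTL.Sat w Φ 0) := by
  obtain ⟨m, e, h1, h2, h3⟩ := hΦ.recognizable
  obtain ⟨S, iS, s0, δ, f, Fs, Es, hS, hL⟩ := h1.exists_streett h2
  refine ⟨S, iS, s0, δ, f, Fs, Es, hS.trans (Nat.pow_le_pow_right two_pos
    (Nat.pow_le_pow_right two_pos h3)), fun w => ?_⟩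
  rw [← hL w]
  simp only [frequently_atTop, eventually_atTop]
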